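/- Let a, c be real numbers with a > 2 and c > 2 which are not positive integers. Then (1−a) J(a−1,1,c) − (1−c) J(a,1,c−1) = ζ(1−a) ζ(1−c) − ∫₀¹ ζ(1−a,q) ζ(1−c,1−q) dq. -/

import Mathlib

open Real MeasureTheory

/-- Hurwitz zeta as a real-valued function of real arguments. -/
noncomputable def hzeta (z q : ℝ) : ℝ := (HurwitzZeta.hurwitzZeta (q : UnitAddCircle) (z : ℂ)).re

/-- `I(a,b,c) = ∫₀¹ ζ(1-a,q) ζ(1-b,q) ζ(1-c,q) dq`. -/
noncomputable def Iint (a b c : ℝ) : ℝ :=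
  ∫ q in (0:ℝ)..1, hzeta (1 - a) q * hzeta (1 - b) q * hzeta (1 - c) q

/-- `J(a,b,c) = ∫₀¹ ζ(1-a,q) ζ(1-b,q) ζ(1-c,1-q) dq`. -/
noncomputable def Jint (a b c : ℝ) : ℝ :=
  ∫ q in (0:ℝ)..1, hzeta (1 - a) q * hzeta (1 - b) q * hzeta (1 - c) (1 - q)

/-- Riemann zeta as a real-valued function of a real argument. -/
noncomputable def rzeta (s : ℝ) : ℝ := (riemannZeta (s : ℂ)).re

open HurwitzZeta

lemma hasDerivAt_ofReal_cpow_of_pos (r : ℂ) {t : ℝ} (ht : 0 < t) :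
    HasDerivAt (fun y : ℝ ↦ (y : ℂ) ^ r) (r * (t : ℂ) ^ (r - 1)) t := by
  have h := (hasDerivAt_id (t : ℂ)).cpow_const (c := r) (Complex.ofReal_mem_slitPlane.2 ht)
  simpa using h.comp_ofReal

lemma norm_cpow_sub_cpow_le {x t : ℝ} (hx : 0 < x) (hxt : x ≤ t) (ht : t ≤ x + 1)
    {r : ℂ} (hr : r.re ≤ 1) :
    ‖(t : ℂ) ^ r - (x : ℂ) ^ r‖ ≤ ‖r‖ * x ^ (r.re - 1) := by
  have h := (convex_Icc x (x + 1)).norm_image_sub_le_of_norm_hasDerivWithin_le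
    (f := fun y : ℝ ↦ (y : ℂ) ^ r) (f' := fun y : ℝ ↦ r * (y : ℂ) ^ (r - 1))
    (x := x) (y := t) (C := ‖r‖ * x ^ (r.re - 1))
    (fun y hy ↦ (hasDerivAt_ofReal_cpow_of_pos r (hx.trans_le hy.1)).hasDerivWithinAt)
    (fun y hy ↦ by
      rw [norm_mul, Complex.norm_cpow_eq_rpow_re_of_pos (hx.trans_le hy.1)]
      gcongr
      simpa using Real.rpow_le_rpow_of_nonpos hx hy.1 (by simpa using hr))
    ⟨le_rfl, by linarith⟩ ⟨hxt, ht⟩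
  refine h.trans (mul_le_of_le_one_right (by positivity) ?_)
  rw [Real.norm_eq_abs, abs_le]
  constructor <;> linarith

lemma norm_cpow_taylor_le {x q : ℝ} (hx : 0 < x) (hq : q ∈ Set.Icc (0 : ℝ) 1)
    {s : ℂ} (hs : -1 ≤ s.re) :
    ‖((x + q : ℝ) : ℂ) ^ (-s) - (x : ℂ) ^ (-s) + s * q * (x : ℂ) ^ (-s - 1)‖ ≤
      ‖s‖ * ‖s + 1‖ * x ^ (-s.re - 2) := by
  have h := (convex_Icc x (x + 1)).norm_image_sub_le_of_norm_hasDerivWithin_le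
    (f := fun y : ℝ ↦ (y : ℂ) ^ (-s) + s * (x : ℂ) ^ (-s - 1) * y)
    (f' := fun y : ℝ ↦ -s * (y : ℂ) ^ (-s - 1) + s * (x : ℂ) ^ (-s - 1) * 1)
    (x := x) (y := x + q) (C := ‖s‖ * ‖s + 1‖ * x ^ (-s.re - 2))
    (fun y hy ↦ ((hasDerivAt_ofReal_cpow_of_pos (-s) (hx.trans_le hy.1)).add
      ((hasDerivAt_id (y : ℂ)).comp_ofReal.const_mul _)).hasDerivWithinAt)
    (fun y hy ↦ by
      have h := norm_cpow_sub_cpow_le hx hy.1 hy.2 (r := -s - 1) (by simp; linarith)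
      rw [show -s * (y : ℂ) ^ (-s - 1) + s * (x : ℂ) ^ (-s - 1) * 1 =
        -s * ((y : ℂ) ^ (-s - 1) - (x : ℂ) ^ (-s - 1)) by ring, norm_mul, norm_neg, mul_assoc]
      gcongr
      refine h.trans (le_of_eq ?_)
      rw [show -s - 1 = -(s + 1) by ring, norm_neg]
      congr 2
      simp
      ring)
    ⟨le_rfl, by linarith⟩ ⟨by linarith [hq.1], by linarith [hq.2]⟩
  refine le_trans (le_of_eq ?_) (h.trans (mul_le_of_le_one_right (by positivity) ?_))
  · congr 1
    push_cast
    ring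
  · rw [Real.norm_eq_abs, abs_le]
    constructor <;> linarith [hq.1, hq.2]

/-- The terms of the second-order Taylor remainder of the Hurwitz zeta function in the shift. -/
noncomputable def hurwitzTaylorTerm (q : ℝ) (n : ℕ) (s : ℂ) : ℂ :=
  ((n + 1 + q : ℝ) : ℂ) ^ (-s) - ((n + 1 : ℝ) : ℂ) ^ (-s)
    + s * q * ((n + 1 : ℝ) : ℂ) ^ (-s - 1)

lemma differentiable_hurwitzTaylorTerm {q : ℝ} (hq : q ∈ Set.Icc (0 : ℝ) 1) (n : ℕ) :
    Differentiable ℂ (hurwitzTaylorTerm q n) := by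
  have h1 : ((n + 1 + q : ℝ) : ℂ) ≠ 0 := by
    have := hq.1
    exact_mod_cast (by positivity : (n + 1 + q : ℝ) ≠ 0)
  have h2 : ((n + 1 : ℝ) : ℂ) ≠ 0 := by exact_mod_cast (by positivity : (n + 1 : ℝ) ≠ 0)
  unfold hurwitzTaylorTerm
  intro s
  refine ((DifferentiableAt.const_cpow (by fun_prop) (.inl h1)).sub
    (DifferentiableAt.const_cpow (by fun_prop) (.inl h2))).add
    (DifferentiableAt.mul (by fun_prop) (DifferentiableAt.const_cpow (by fun_prop) (.inl h2)))

lemma differentiableOn_tsum_hurwitzTaylorTerm {q : ℝ} (hq : q ∈ Set.Icc (0 : ℝ) 1) :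
    DifferentiableOn ℂ (fun s ↦ ∑' n, hurwitzTaylorTerm q n s)
      {s | -1 / 2 < s.re ∧ ‖s‖ < 3} := by
  have hu : Summable fun n : ℕ ↦ 3 * 4 * ((n : ℝ) + 1) ^ (-3 / 2 : ℝ) := by
    refine Summable.mul_left _ (((Real.summable_one_div_nat_add_rpow 1 (3 / 2)).2
      (by norm_num)).congr fun n ↦ ?_)
    rw [abs_of_pos (by positivity), neg_div, Real.rpow_neg (by positivity), one_div]
  refine Complex.differentiableOn_tsum_of_summable_norm hu
    (fun n ↦ (differentiable_hurwitzTaylorTerm hq n).differentiableOn) ?_ ?_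
  · exact (isOpen_lt continuous_const Complex.continuous_re).inter
      (isOpen_lt continuous_norm continuous_const)
  · rintro n s ⟨hs, hs'⟩
    refine (norm_cpow_taylor_le (by positivity) hq (by linarith)).trans ?_
    have : ‖s + 1‖ ≤ 4 := (norm_add_le _ _).trans (by rw [norm_one]; linarith)
    gcongr ?_ * ?_ * ?_
    exact Real.rpow_le_rpow_of_exponent_le (by linarith [n.cast_nonneg (α := ℝ)]) (by linarith)

lemma tsum_hurwitzTaylorTerm {q : ℝ} (hq : q ∈ Set.Ioo (0 : ℝ) 1) {s : ℂ} (hs : 1 < s.re) :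
    ∑' n, hurwitzTaylorTerm q n s =
      (hurwitzZeta q s - hurwitzZeta (0 : ℝ) s) - (q : ℂ) ^ (-s)
        + s * q * riemannZeta (s + 1) := by
  have h1 := hasSum_hurwitzZeta_of_one_lt_re (Set.Ioo_subset_Icc_self hq) hs
  have h2 := hasSum_hurwitzZeta_of_one_lt_re (a := 0) (by simp) hs
  have h3 := hasSum_hurwitzZeta_of_one_lt_re (a := 0) (by simp) (s := s + 1)
    (by simp; linarith)
  rw [← hasSum_nat_add_iff' 1] at h1 h2 h3
  have hs0 : s ≠ 0 := by rintro rfl; norm_num at hs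
  have hs1 : s + 1 ≠ 0 := by
    intro h
    have := congrArg Complex.re h
    simp at this
    linarith
  have h := ((h1.sub h2).add (h3.mul_left (s * q))).tsum_eq
  simp only [Finset.range_one, Finset.sum_singleton, Nat.cast_zero, zero_add, Complex.ofReal_zero,
    Complex.zero_cpow hs0, Complex.zero_cpow hs1, div_zero, sub_zero] at h
  have hz : hurwitzZeta ((0 : ℝ) : UnitAddCircle) (s + 1) = riemannZeta (s + 1) := by
    rw [← hurwitzZeta_zero]; rfl
  rw [hz] at h
  rw [Complex.cpow_neg, ← one_div]
  rw [sub_right_comm] at h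
  rw [← h]
  refine tsum_congr fun n ↦ ?_
  simp only [hurwitzTaylorTerm]
  rw [show -s - 1 = -(s + 1) by ring]
  simp only [Complex.cpow_neg]
  push_cast
  simp only [add_zero, one_div]

lemma hurwitzZeta_apply_zero {q : ℝ} (hq : q ∈ Set.Ioo (0 : ℝ) 1) :
    hurwitzZeta q 0 = 1 / 2 - q := by
  have hq' := Set.Ioo_subset_Icc_self hq
  have hq0 : (q : ℂ) ≠ 0 := by exact_mod_cast hq.1.ne'
  set U : Set ℂ := {s | 0 < s.re} ∩ Metric.ball 0 3 with hU
  set H : ℂ → ℂ := fun s ↦ (hurwitzZeta q s - hurwitzZeta (0 : ℝ) s) - (q : ℂ) ^ (-s)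
    + s * q * riemannZeta (s + 1) with hH
  have hUo : IsOpen U := (isOpen_lt continuous_const Complex.continuous_re).inter Metric.isOpen_ball
  have hUsub : U ⊆ {s | -1 / 2 < s.re ∧ ‖s‖ < 3} := by
    rintro s ⟨hs, hs'⟩
    simp only [Set.mem_ofPred_eq, mem_ball_zero_iff] at hs hs' ⊢
    exact ⟨by linarith, hs'⟩
  have hdiff := differentiable_hurwitzZeta_sub_hurwitzZeta q (0 : ℝ)
  have hcp : Differentiable ℂ fun s : ℂ ↦ (q : ℂ) ^ (-s) :=
    fun s ↦ DifferentiableAt.const_cpow (by fun_prop) (.inl hq0)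
  have hHd : DifferentiableOn ℂ H U := by
    rintro s ⟨hs, -⟩
    have hs1 : s + 1 ≠ 1 := by
      intro h
      simp only [add_eq_right] at h
      simp [h] at hs
    refine DifferentiableAt.differentiableWithinAt ?_
    refine ((hdiff s).sub (hcp s)).add (DifferentiableAt.mul (by fun_prop) ?_)
    exact (differentiableAt_riemannZeta hs1).comp s (by fun_prop)
  have hGd := differentiableOn_tsum_hurwitzTaylorTerm hq'
  have h2U : (2 : ℂ) ∈ U := by simp [hU]; norm_num
  have heq : Set.EqOn (fun s ↦ ∑' n, hurwitzTaylorTerm q n s) H U := by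
    refine AnalyticOnNhd.eqOn_of_preconnected_of_eventuallyEq
      ((hGd.mono hUsub).analyticOnNhd hUo) (hHd.analyticOnNhd hUo)
      ((convex_halfSpace_re_gt 0).inter (convex_ball 0 3)).isPreconnected h2U ?_
    filter_upwards [(isOpen_lt continuous_const Complex.continuous_re).mem_nhds
      (show (1 : ℝ) < (2 : ℂ).re by norm_num)] with s hs
    exact tsum_hurwitzTaylorTerm hq hs
  have hne : Filter.NeBot (nhdsWithin (0 : ℂ) U) := by
    rw [hU, nhdsWithin_inter_of_mem' (mem_nhdsWithin_of_mem_nhds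
      (Metric.ball_mem_nhds 0 (by norm_num)))]
    rw [← mem_closure_iff_nhdsWithin_neBot, Complex.closure_setOfPred_lt_re]
    simp
  have hV : IsOpen {s : ℂ | -1 / 2 < s.re ∧ ‖s‖ < 3} :=
    (isOpen_lt continuous_const Complex.continuous_re).inter
      (isOpen_lt continuous_norm continuous_const)
  have hG0 : Filter.Tendsto (fun s ↦ ∑' n, hurwitzTaylorTerm q n s) (nhdsWithin 0 U) (nhds 0) := by
    have hc := (hGd.differentiableAt (hV.mem_nhds (x := 0) (by norm_num))).continuousAt
    have h0 : ∑' n, hurwitzTaylorTerm q n 0 = 0 := by simp [hurwitzTaylorTerm]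
    have := hc.tendsto
    rw [h0] at this
    exact this.mono_left nhdsWithin_le_nhds
  have hz : Filter.Tendsto (fun s : ℂ ↦ s * riemannZeta (s + 1)) (nhdsWithin 0 U) (nhds 1) := by
    have ht : Filter.Tendsto (fun s : ℂ ↦ s + 1) (nhdsWithin 0 U) (nhdsWithin 1 {1}ᶜ) := by
      refine tendsto_nhdsWithin_iff.2 ⟨?_, ?_⟩
      · have : ContinuousAt (fun s : ℂ ↦ s + 1) 0 := by fun_prop
        simpa using this.tendsto.mono_left nhdsWithin_le_nhds
      · filter_upwards [self_mem_nhdsWithin] with s hs h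
        simp only [Set.mem_singleton_iff, add_eq_right] at h
        simp [hU, h] at hs
    refine (riemannZeta_residue_one.comp ht).congr fun s ↦ ?_
    simp
  have hH0 : Filter.Tendsto H (nhdsWithin 0 U)
      (nhds ((hurwitzZeta q 0 - hurwitzZeta (0 : ℝ) 0) - (q : ℂ) ^ (-0 : ℂ) + q * 1)) := by
    have h := (((hdiff 0).continuousAt.tendsto.sub (hcp 0).continuousAt.tendsto).mono_left
      (nhdsWithin_le_nhds (s := U))).add (hz.const_mul (q : ℂ))
    refine h.congr fun s ↦ ?_
    simp only [hH]
    ring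
  have hfin := tendsto_nhds_unique (hG0.congr' (by
    filter_upwards [self_mem_nhdsWithin] with s hs using heq hs)) hH0
  have hz0 : hurwitzZeta ((0 : ℝ) : UnitAddCircle) 0 = -1 / 2 := by
    rw [← riemannZeta_zero, ← hurwitzZeta_zero]; rfl
  rw [hz0, neg_zero, Complex.cpow_zero] at hfin
  linear_combination -hfin

lemma expZeta_eq_tsum (q : ℝ) {s : ℝ} (hs : 1 < s) :
    expZeta q s = ∑' n : ℕ, Complex.exp (2 * π * Complex.I * q * n) / (n : ℂ) ^ (s : ℂ) :=
  (hasSum_expZeta_of_one_lt_re q (s := s) (by simpa using hs)).tsum_eq.symm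

lemma norm_exp_div_cpow_le (q s : ℝ) (n : ℕ) (hs : 1 < s) :
    ‖Complex.exp (2 * π * Complex.I * q * n) / (n : ℂ) ^ (s : ℂ)‖ ≤ 1 / (n : ℝ) ^ s := by
  rw [norm_div, show 2 * π * Complex.I * q * n = ((2 * π * q * n : ℝ) : ℂ) * Complex.I by
    push_cast; ring, Complex.norm_exp_ofReal_mul_I, Complex.norm_natCast_cpow_of_re_ne_zero]
  · simp
  · simp; linarith

lemma continuous_expZeta_ofReal {s : ℝ} (hs : 1 < s) :
    Continuous fun q : ℝ ↦ expZeta q s := by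
  simp_rw [fun q ↦ expZeta_eq_tsum q hs]
  refine continuous_tsum (fun n ↦ by fun_prop) (Real.summable_one_div_nat_rpow.2 hs)
    fun n q ↦ norm_exp_div_cpow_le q s n hs

lemma hasDerivAt_expZeta_ofReal {s : ℝ} (hs : 2 < s) (q : ℝ) :
    HasDerivAt (fun q : ℝ ↦ expZeta q s) (2 * π * Complex.I * expZeta q (s - 1 : ℝ)) q := by
  have hs1 : 1 < s - 1 := by linarith
  simp_rw [fun q ↦ expZeta_eq_tsum q (by linarith : 1 < s), expZeta_eq_tsum q hs1,
    ← tsum_mul_left]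
  refine hasDerivAt_tsum (𝕜 := ℝ) (u := fun n : ℕ ↦ 2 * π * (1 / (n : ℝ) ^ (s - 1)))
    (g' := fun n q ↦ 2 * π * Complex.I *
      (Complex.exp (2 * π * Complex.I * q * n) / (n : ℂ) ^ ((s - 1 : ℝ) : ℂ)))
    (y₀ := 0)
    ((Real.summable_one_div_nat_rpow.2 hs1).mul_left _) (fun n y ↦ ?_) (fun n y ↦ ?_) ?_ q
  · have h := (((((hasDerivAt_id (y : ℂ)).const_mul (2 * π * Complex.I)).mul_const
      (n : ℂ)).cexp).div_const ((n : ℂ) ^ (s : ℂ))).comp_ofReal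
    convert! h using 1
    rcases eq_or_ne n 0 with rfl | hn
    · have : (s : ℂ) - 1 ≠ 0 := by exact_mod_cast (by linarith : s - 1 ≠ 0)
      simp [Complex.zero_cpow this]
    · have hn' : (n : ℂ) ≠ 0 := by exact_mod_cast hn
      have : (n : ℂ) ^ (s : ℂ) ≠ 0 := by simp [Complex.cpow_eq_zero_iff, hn]
      push_cast
      rw [Complex.cpow_sub _ _ hn', Complex.cpow_one]
      simp only [id]
      field_simp
  · rw [norm_mul]
    have : ‖2 * π * Complex.I‖ = 2 * π := by simp [abs_of_pos Real.pi_pos]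
    rw [this]
    gcongr
    exact norm_exp_div_cpow_le y (s - 1) n hs1
  · exact (hasSum_expZeta_of_one_lt_re 0 (by simp; linarith)).summable

lemma hurwitzZeta_one_sub_ofReal (q : ℝ) {s : ℝ} (hs : 1 < s) :
    hurwitzZeta q (1 - s : ℝ) = (2 * π) ^ (-s : ℂ) * Complex.Gamma s *
      (Complex.exp (-π * Complex.I * s / 2) * expZeta q s +
        Complex.exp (π * Complex.I * s / 2) * expZeta ((-q : ℝ) : UnitAddCircle) s) := by
  push_cast
  rw [hurwitzZeta_one_sub]
  · rfl
  · intro n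
    exact_mod_cast (by linarith [n.cast_nonneg (α := ℝ)] : s ≠ -n)
  · right
    exact_mod_cast hs.ne'

lemma continuous_hurwitzZeta_ofReal {s : ℝ} (hs : 1 < s) :
    Continuous fun q : ℝ ↦ hurwitzZeta q (1 - s : ℝ) := by
  simp_rw [fun q ↦ hurwitzZeta_one_sub_ofReal q hs]
  have h := continuous_expZeta_ofReal hs
  have h' : Continuous fun q : ℝ ↦ expZeta ((-q : ℝ) : UnitAddCircle) s := h.comp continuous_neg
  exact ((h.const_mul _).add (h'.const_mul _)).const_mul _

lemma hasDerivAt_hurwitzZeta_ofReal {s : ℝ} (hs : 2 < s) (q : ℝ) :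
    HasDerivAt (fun q : ℝ ↦ hurwitzZeta q (1 - s : ℝ))
      ((s - 1 : ℝ) * hurwitzZeta q (1 - (s - 1) : ℝ)) q := by
  simp_rw [fun q ↦ hurwitzZeta_one_sub_ofReal q (by linarith : 1 < s),
    hurwitzZeta_one_sub_ofReal q (by linarith : 1 < s - 1)]
  have h := hasDerivAt_expZeta_ofReal hs q
  have h' := (hasDerivAt_expZeta_ofReal hs (-q)).scomp q (hasDerivAt_neg q)
  convert! (((h.const_mul (Complex.exp (-π * Complex.I * s / 2))).add
    (h'.const_mul (Complex.exp (π * Complex.I * s / 2)))).const_mul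
      ((2 * π) ^ (-s : ℂ) * Complex.Gamma s)) using 1
  have hs1 : ((s - 1 : ℝ) : ℂ) ≠ 0 := by exact_mod_cast (by linarith : s - 1 ≠ 0)
  have hG : Complex.Gamma s = (s - 1 : ℝ) * Complex.Gamma (s - 1 : ℝ) := by
    rw [← Complex.Gamma_add_one _ hs1]; push_cast; ring_nf
  have hP : (2 * π : ℂ) ^ (-((s - 1 : ℝ) : ℂ)) = (2 * π : ℂ) ^ (-s : ℂ) * (2 * π) := by
    have : (2 * π : ℂ) ≠ 0 := by simp [Real.pi_ne_zero]
    rw [show -((s - 1 : ℝ) : ℂ) = -s + 1 by push_cast; ring, Complex.cpow_add _ _ this,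
      Complex.cpow_one]
  have he1 : Complex.exp (-π * Complex.I * (s - 1 : ℝ) / 2) =
      Complex.exp (-π * Complex.I * s / 2) * Complex.I := by
    rw [show -π * Complex.I * (s - 1 : ℝ) / 2 = -π * Complex.I * s / 2 + π / 2 * Complex.I by
      push_cast; ring, Complex.exp_add, Complex.exp_pi_div_two_mul_I]
  have he2 : Complex.exp (π * Complex.I * (s - 1 : ℝ) / 2) =
      Complex.exp (π * Complex.I * s / 2) * -Complex.I := by
    rw [show π * Complex.I * (s - 1 : ℝ) / 2 = π * Complex.I * s / 2 + -π / 2 * Complex.I by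
      push_cast; ring, Complex.exp_add, Complex.exp_neg_pi_div_two_mul_I]
  rw [hG, hP, he1, he2]
  simp only [neg_smul, one_smul]
  ring

lemma continuous_hzeta_one_sub {s : ℝ} (hs : 1 < s) : Continuous (hzeta (1 - s)) :=
  Complex.continuous_re.comp (continuous_hurwitzZeta_ofReal hs)

lemma hasDerivAt_hzeta_one_sub {s : ℝ} (hs : 2 < s) (q : ℝ) :
    HasDerivAt (hzeta (1 - s)) ((s - 1) * hzeta (1 - (s - 1)) q) q := by
  have h := Complex.reCLM.hasFDerivAt.comp_hasDerivAt q (hasDerivAt_hurwitzZeta_ofReal hs q)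
  change HasDerivAt (fun q ↦ hzeta (1 - s) q) _ q
  simpa [hzeta, Function.comp_def] using h

lemma hzeta_zero_left {q : ℝ} (hq : q ∈ Set.Ioo (0 : ℝ) 1) : hzeta 0 q = 1 / 2 - q := by
  rw [hzeta, Complex.ofReal_zero, hurwitzZeta_apply_zero hq]
  simp

lemma hzeta_zero_right (z : ℝ) : hzeta z 0 = rzeta z := by
  rw [hzeta, rzeta, ← hurwitzZeta_zero]
  rfl

lemma hzeta_one_right (z : ℝ) : hzeta z 1 = rzeta z := by
  rw [← hzeta_zero_right, hzeta, hzeta, AddCircle.coe_period]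
  rfl

lemma Jint_one_middle (a c : ℝ) : Jint a 1 c =
    ∫ q in (0:ℝ)..1, hzeta (1 - a) q * (1 / 2 - q) * hzeta (1 - c) (1 - q) := by
  refine intervalIntegral.integral_congr_uIoo fun q hq ↦ ?_
  rw [Set.uIoo_of_le zero_le_one] at hq
  simp only [sub_self, hzeta_zero_left hq]

theorem J_reduction_identity (a c : ℝ) (ha : 2 < a) (hc : 2 < c)
    (ha' : ∀ k : ℕ, a ≠ k) (hc' : ∀ k : ℕ, c ≠ k) :
    (1 - a) * Jint (a - 1) 1 c - (1 - c) * Jint a 1 (c - 1) =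
      rzeta (1 - a) * rzeta (1 - c) -
        ∫ q in (0:ℝ)..1, hzeta (1 - a) q * hzeta (1 - c) (1 - q) := by
  have hf := continuous_hzeta_one_sub (by linarith : 1 < a)
  have hf' := continuous_hzeta_one_sub (by linarith : 1 < a - 1)
  have hg : Continuous fun q ↦ hzeta (1 - c) (1 - q) :=
    (continuous_hzeta_one_sub (by linarith : 1 < c)).comp (by fun_prop)
  have hg' : Continuous fun q ↦ hzeta (1 - (c - 1)) (1 - q) :=
    (continuous_hzeta_one_sub (by linarith : 1 < c - 1)).comp (by fun_prop)
  have hdg (q : ℝ) : HasDerivAt (fun q ↦ hzeta (1 - c) (1 - q))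
      (-((c - 1) * hzeta (1 - (c - 1)) (1 - q))) q := by
    have h := (hasDerivAt_hzeta_one_sub hc (1 - q)).comp q ((hasDerivAt_id q).const_sub 1)
    simpa [Function.comp_def] using h
  have hdh (q : ℝ) : HasDerivAt (fun q : ℝ ↦ 1 / 2 - q) (-1) q := by
    exact (hasDerivAt_id q).const_sub (1 / 2)
  have hftc := intervalIntegral.integral_eq_sub_of_hasDerivAt (a := 0) (b := 1)
    (fun q _ ↦ ((hasDerivAt_hzeta_one_sub ha q).mul (hdh q)).mul (hdg q))
    (Continuous.intervalIntegrable (by fun_prop) _ _)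
  have i1 : IntervalIntegrable (fun q ↦ hzeta (1 - (a - 1)) q * (1 / 2 - q) *
      hzeta (1 - c) (1 - q)) volume 0 1 := Continuous.intervalIntegrable (by fun_prop) _ _
  have i2 : IntervalIntegrable (fun q ↦ hzeta (1 - a) q * (1 / 2 - q) *
      hzeta (1 - (c - 1)) (1 - q)) volume 0 1 := Continuous.intervalIntegrable (by fun_prop) _ _
  have i3 : IntervalIntegrable (fun q ↦ hzeta (1 - a) q * hzeta (1 - c) (1 - q)) volume 0 1 :=
    Continuous.intervalIntegrable (by fun_prop) _ _
  have hsplit := intervalIntegral.integral_sub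
    ((i1.const_mul (a - 1)).sub (i2.const_mul (c - 1))) i3
  rw [intervalIntegral.integral_sub (i1.const_mul (a - 1)) (i2.const_mul (c - 1)),
    intervalIntegral.integral_const_mul, intervalIntegral.integral_const_mul,
    ← Jint_one_middle, ← Jint_one_middle] at hsplit
  rw [intervalIntegral.integral_congr (g := fun q ↦
    (a - 1) * (hzeta (1 - (a - 1)) q * (1 / 2 - q) * hzeta (1 - c) (1 - q)) -
      (c - 1) * (hzeta (1 - a) q * (1 / 2 - q) * hzeta (1 - (c - 1)) (1 - q)) -
      hzeta (1 - a) q * hzeta (1 - c) (1 - q)) (fun q _ ↦ by simp only [Pi.mul_apply]; ring),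
    hsplit] at hftc
  simp only [Pi.mul_apply, sub_self, sub_zero, hzeta_zero_right, hzeta_one_right] at hftc
  linear_combination -hftc
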